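/- Let (X,d) be a complete separable metric space and m a nonnegative Borel measure on X, finite on bounded sets, with 0 < m(X) < ∞. Then for all exponents 1 < p < q < ∞ one has p·(λ_{1,p}(X))^{1/p} ≤ q·(λ_{1,q}(X))^{1/q}, equivalently λ_{1,p}(X) ≤ (q/p)^p · (λ_{1,q}(X))^{p/q}. -/

import Mathlib

open MeasureTheory Filter Topology ENNReal

/-- The slope (pointwise Lipschitz constant) of `f` at `x`:
`lip f x = limsup_{y → x} |f y - f x| / d(y,x)`, with the convention that it is `0`
at isolated points (automatic, since the limsup over the bottom filter is `0`). -/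
noncomputable def lipSlope {X : Type*} [MetricSpace X] (f : X → ℝ) (x : X) : ℝ :=
  Filter.limsup (fun y => |f y - f x| / dist y x) (𝓝[≠] x)

/-- Lipschitz functions with bounded support. -/
def LipBS {X : Type*} [MetricSpace X] (f : X → ℝ) : Prop :=
  (∃ K : NNReal, LipschitzWith K f) ∧ Bornology.IsBounded (Function.support f)

/-- The first nontrivial `p`-eigenvalue `λ_{1,p}` (finite measure case):
the infimum of `(∫ lip(f)^p dm) / (∫ |f|^p dm)` over nonzero `f ∈ Lip_bs(X)` with
`∫ |f|^{p-2} f dm = 0`. -/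
noncomputable def lambdaOneP {X : Type*} [MetricSpace X] [MeasurableSpace X]
    (m : Measure X) (p : ℝ) : ℝ≥0∞ :=
  sInf { l : ℝ≥0∞ | ∃ f : X → ℝ, LipBS f ∧ ¬ (f =ᵐ[m] 0) ∧
    (∫ x, |f x| ^ (p - 2) * f x ∂m) = 0 ∧
    l = (∫⁻ x, ENNReal.ofReal ((lipSlope f x) ^ p) ∂m) /
        (∫⁻ x, ENNReal.ofReal (|f x| ^ p) ∂m) }


noncomputable def sg (b t : ℝ) : ℝ := |t| ^ b * t

lemma abs_sg {b : ℝ} (hb : -1 < b) (t : ℝ) : |sg b t| = |t| ^ (b + 1) := by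
  unfold sg
  rw [abs_mul, abs_of_nonneg (Real.rpow_nonneg (abs_nonneg t) b)]
  rcases eq_or_ne t 0 with rfl | ht
  · simp [Real.zero_rpow (by linarith : b + 1 ≠ 0)]
  · rw [Real.rpow_add (abs_pos.2 ht), Real.rpow_one]

lemma continuous_sg {b : ℝ} (hb : -1 < b) : Continuous (sg b) := by
  rw [continuous_iff_continuousAt]
  intro t
  rcases eq_or_ne t 0 with rfl | ht
  · have h0 : sg b 0 = 0 := by simp [sg]
    rw [ContinuousAt, h0]
    apply squeeze_zero_norm (a := fun t => |t| ^ (b + 1))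
    · intro t; rw [Real.norm_eq_abs, abs_sg hb]
    · have : Continuous (fun t : ℝ => |t| ^ (b + 1)) :=
        continuous_abs.rpow_const (fun _ => Or.inr (by linarith))
      have h := this.tendsto 0
      simpa [Real.zero_rpow (by linarith : b + 1 ≠ 0)] using h
  · unfold sg
    exact (continuous_abs.continuousAt.rpow_const (Or.inl (abs_ne_zero.2 ht))).mul continuousAt_id

lemma hasDerivAt_sg {b : ℝ} (hb : 0 < b) (t : ℝ) :
    HasDerivAt (sg b) ((b + 1) * |t| ^ b) t := by
  rcases eq_or_ne t 0 with rfl | ht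
  · rw [hasDerivAt_iff_tendsto_slope]
    have : Continuous (fun t : ℝ => |t| ^ b) :=
        continuous_abs.rpow_const (fun _ => Or.inr hb.le)
    have h := (this.tendsto 0).mono_left (nhdsWithin_le_nhds (s := {0}ᶜ))
    simp only [abs_zero, Real.zero_rpow hb.ne', mul_zero] at h ⊢
    refine h.congr' ?_
    filter_upwards [self_mem_nhdsWithin] with y hy
    have hy : y ≠ 0 := hy
    simp [slope_def_field, sg, hy]
  · have h := ((hasDerivAt_abs ht).rpow_const (p := b) (Or.inl (abs_ne_zero.2 ht))).mul
      (hasDerivAt_id t)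
    refine h.congr_deriv ?_
    have h1 : |t| ^ b = |t| ^ (b - 1) * |t| := by
      rw [← Real.rpow_add_one (abs_ne_zero.2 ht)]; ring_nf
    have h2 : (SignType.sign t : ℝ) * t = |t| := by simp
    simp only [id, mul_one]
    rw [h1, ← h2]; ring

lemma sg_lip {b : ℝ} (hb : 0 < b) {M s t : ℝ} (hs : |s| ≤ M) (ht : |t| ≤ M) :
    |sg b s - sg b t| ≤ (b + 1) * M ^ b * |s - t| := by
  have := Convex.norm_image_sub_le_of_norm_hasDerivWithin_le (f := sg b)
    (f' := fun t => (b + 1) * |t| ^ b) (s := Set.Icc (-M) M) (C := (b + 1) * M ^ b) (x := t) (y := s)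
    (fun x _ => (hasDerivAt_sg hb x).hasDerivWithinAt) ?_ (convex_Icc _ _) (abs_le.1 ht) (abs_le.1 hs)
  · simpa using this
  · intro x hx
    have hx : |x| ≤ M := abs_le.2 hx
    rw [Real.norm_eq_abs, abs_of_nonneg (by positivity)]
    gcongr

/-- minimality pointwise inequality -/
lemma pt_min {q : ℝ} (hq : 1 < q) (t c : ℝ) :
    |t| ^ q - q * c * sg (q - 2) t ≤ |t - c| ^ q := by
  have hc : Real.HolderConjugate (q / (q - 1)) q := (Real.HolderConjugate.conjExponent hq).symm
  have y := Real.young_inequality_of_nonneg (a := |t| ^ (q - 1)) (b := |t - c|)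
    (by positivity) (by positivity) hc
  have hq1 : q - 1 ≠ 0 := by linarith
  rw [← Real.rpow_mul (abs_nonneg t), mul_div_cancel₀ _ hq1] at y
  have h1 : sg (q - 2) t * (t - c) ≤ |t| ^ (q - 1) * |t - c| := by
    refine (le_abs_self _).trans ?_
    rw [abs_mul, abs_sg (by linarith)]
    apply le_of_eq; ring_nf
  have h2 : sg (q - 2) t * t = |t| ^ q := by
    unfold sg
    rcases eq_or_ne t 0 with rfl | ht
    · simp [Real.zero_rpow (by linarith : q ≠ 0)]
    · have : |t| ^ q = |t| ^ (q - 2) * |t| ^ (2:ℕ) := by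
        rw [← Real.rpow_natCast, ← Real.rpow_add (abs_pos.2 ht)]; norm_num
      rw [this, sq_abs]; ring
  have h3 : |t| ^ q - c * sg (q - 2) t ≤ |t| ^ q / (q / (q - 1)) + |t - c| ^ q / q := by
    nlinarith
  have h4 := mul_le_mul_of_nonneg_left h3 (by linarith : 0 ≤ q)
  have h5 : q * (|t| ^ q / (q / (q - 1)) + |t - c| ^ q / q) = (q - 1) * |t| ^ q + |t - c| ^ q := by
    field_simp
  nlinarith

section slope
variable {X : Type*} [MetricSpace X]

lemma quot_bdd {f : X → ℝ} {K : NNReal} (hf : LipschitzWith K f) (x y : X) :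
    |f y - f x| / dist y x ≤ K := by
  apply div_le_of_le_mul₀ dist_nonneg K.2
  simpa [Real.dist_eq] using hf.dist_le_mul y x

lemma lipSlope_bot {f : X → ℝ} {x : X} (h : 𝓝[≠] x = ⊥) : lipSlope f x = 0 := by
  simp [lipSlope, h, limsup, limsSup]

lemma isBdd {f : X → ℝ} {K : NNReal} (hf : LipschitzWith K f) (x : X) :
    IsBoundedUnder (· ≤ ·) (𝓝[≠] x) (fun y => |f y - f x| / dist y x) :=
  isBoundedUnder_of ⟨K, fun y => quot_bdd hf x y⟩

lemma isBddB {f : X → ℝ} (x : X) :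
    IsBoundedUnder (· ≥ ·) (𝓝[≠] x) (fun y => |f y - f x| / dist y x) :=
  isBoundedUnder_of ⟨0, fun y => by positivity⟩

lemma lipSlope_nonneg {f : X → ℝ} {K : NNReal} (hf : LipschitzWith K f) (x : X) :
    0 ≤ lipSlope f x := by
  rcases (𝓝[≠] x).eq_or_neBot with h | h
  · rw [lipSlope_bot h]
  · refine le_limsup_of_frequently_le (Frequently.of_forall fun y => by positivity) (isBdd hf x)

lemma lipSlope_le_of {f : X → ℝ} {x : X} {C : ℝ} (hC : 0 ≤ C)
    (h : ∀ᶠ y in 𝓝[≠] x, |f y - f x| / dist y x ≤ C) : lipSlope f x ≤ C := by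
  rcases (𝓝[≠] x).eq_or_neBot with h' | h'
  · rwa [lipSlope_bot h']
  · exact limsup_le_of_le (isBddB x).isCoboundedUnder_le h

lemma lipSlope_le {f : X → ℝ} {K : NNReal} (hf : LipschitzWith K f) (x : X) :
    lipSlope f x ≤ K :=
  lipSlope_le_of K.2 (Eventually.of_forall fun y => quot_bdd hf x y)

lemma lipSlope_chain {f h : X → ℝ} {K : NNReal} (hf : LipschitzWith K f) {x : X} {b c : ℝ}
    (hb : 0 < b) (hh : ∀ᶠ y in 𝓝 x, h y = sg b (f y - c)) :
    lipSlope h x ≤ (b + 1) * |f x - c| ^ b * lipSlope f x := by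
  have key : ∀ ε > 0, lipSlope h x ≤ (b + 1) * (|f x - c| + ε) ^ b * (lipSlope f x + ε) := by
    intro ε hε
    have hn := lipSlope_nonneg hf x
    apply lipSlope_le_of (by positivity)
    have h1 : ∀ᶠ y in 𝓝 x, |f y - c| < |f x - c| + ε := by
      have : Continuous (fun y => |f y - c|) := (hf.continuous.sub continuous_const).abs
      exact (this.tendsto x).eventually_lt_const (by linarith)
    have h2 : ∀ᶠ y in 𝓝[≠] x, |f y - f x| / dist y x < lipSlope f x + ε :=
      eventually_lt_of_limsup_lt (by unfold lipSlope; linarith) (isBdd hf x)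
    filter_upwards [h1.filter_mono nhdsWithin_le_nhds, h2, hh.filter_mono nhdsWithin_le_nhds] with y h1 h2 h3
    rw [h3, hh.self_of_nhds]
    have := sg_lip hb h1.le (by linarith : |f x - c| ≤ |f x - c| + ε)
    calc _ ≤ ((b + 1) * (|f x - c| + ε) ^ b * |f y - f x|) / dist y x := by
            gcongr; simpa using this
      _ = (b + 1) * (|f x - c| + ε) ^ b * (|f y - f x| / dist y x) := by ring
      _ ≤ _ := by gcongr
  have hc : Continuous (fun ε : ℝ => (b + 1) * (|f x - c| + ε) ^ b * (lipSlope f x + ε)) := by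
    refine (continuous_const.mul ((continuous_const.add continuous_id).rpow_const
      (fun _ => Or.inr hb.le))).mul (continuous_const.add continuous_id)
  have ht := (hc.tendsto 0).mono_left (nhdsWithin_le_nhds (s := Set.Ioi 0))
  simp only [add_zero] at ht
  exact ge_of_tendsto ht (eventually_nhdsWithin_of_forall key)

lemma measurable_lipSlope [MeasurableSpace X] [BorelSpace X] {f : X → ℝ} {K : NNReal}
    (hf : LipschitzWith K f) : Measurable (lipSlope f) := by
  apply measurable_of_Ioi
  intro a
  rcases lt_or_ge a 0 with ha | ha
  · have : lipSlope f ⁻¹' Set.Ioi a = Set.univ := by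
      ext x; simpa using ha.trans_le (lipSlope_nonneg hf x)
    rw [this]; exact MeasurableSet.univ
  · have : lipSlope f ⁻¹' Set.Ioi a = ⋃ b : {b : ℚ // a < b}, ⋂ n : ℕ,
        ⋃ y : X, {x | x ≠ y ∧ dist y x < 1 / ((n:ℝ) + 1) ∧ ((b : ℚ) : ℝ) * dist y x < |f y - f x|} := by
      ext x
      simp only [Set.mem_preimage, Set.mem_Ioi, Set.mem_iUnion, Set.mem_iInter, Set.mem_ofPred_eq]
      constructor
      · intro h
        rcases (𝓝[≠] x).eq_or_neBot with h' | h'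
        · rw [lipSlope_bot h'] at h; linarith
        obtain ⟨b, hb1, hb2⟩ := exists_rat_btwn h
        refine ⟨⟨b, hb1⟩, fun n => ?_⟩
        have h1 : ∃ᶠ y in 𝓝[≠] x, (b:ℝ) < |f y - f x| / dist y x :=
          frequently_lt_of_lt_limsup (isBddB x).isCoboundedUnder_le hb2
        have h2 : ∀ᶠ y in 𝓝[≠] x, y ∈ Metric.ball x (1 / ((n:ℝ) + 1)) :=
          nhdsWithin_le_nhds (Metric.ball_mem_nhds x (by positivity))
        obtain ⟨y, hy1, hy2, hy3⟩ := (h1.and_eventually (h2.and self_mem_nhdsWithin)).exists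
        have hy3 : y ≠ x := hy3
        exact ⟨y, hy3.symm, hy2, (lt_div_iff₀ (dist_pos.2 hy3)).1 hy1⟩
      · rintro ⟨⟨b, hb⟩, h⟩
        refine hb.trans_le ?_
        refine le_limsup_of_frequently_le ?_ (isBdd hf x)
        rw [(Metric.nhdsWithin_basis_ball).frequently_iff]
        intro ε hε
        obtain ⟨n, hn⟩ := exists_nat_one_div_lt hε
        obtain ⟨y, h1, h2, h3⟩ := h n
        exact ⟨y, ⟨h2.trans hn, h1.symm⟩, ((lt_div_iff₀ (dist_pos.2 h1.symm)).2 h3).le⟩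
    rw [this]
    refine MeasurableSet.iUnion fun b => MeasurableSet.iInter fun n => IsOpen.measurableSet ?_
    refine isOpen_iUnion fun y => ?_
    have hc := hf.continuous
    have o1 : IsOpen {x : X | dist y x < 1 / ((n:ℝ) + 1)} :=
      isOpen_lt (by fun_prop) (by fun_prop)
    have o2 : IsOpen {x : X | ((b : ℚ) : ℝ) * dist y x < |f y - f x|} :=
      isOpen_lt (by fun_prop) (by fun_prop)
    exact isOpen_ne.inter (o1.inter o2)

end slope

lemma lam_mul_le {X : Type*} [MetricSpace X] [MeasurableSpace X]
    (m : Measure X) {p : ℝ} (hp : 1 < p) {h : X → ℝ} (hh : LipBS h)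
    (h0 : (∫ x, |h x| ^ (p - 2) * h x ∂m) = 0) :
    lambdaOneP m p * (∫⁻ x, ENNReal.ofReal (|h x| ^ p) ∂m) ≤
      ∫⁻ x, ENNReal.ofReal ((lipSlope h x) ^ p) ∂m := by
  by_cases hz : h =ᵐ[m] 0
  · have : (∫⁻ x, ENNReal.ofReal (|h x| ^ p) ∂m) = 0 := by
      rw [← lintegral_zero (μ := m)]
      apply lintegral_congr_ae
      filter_upwards [hz] with x hx
      simp [hx, Real.zero_rpow (by linarith : p ≠ 0)]
    simp [this]
  · apply ENNReal.mul_le_of_le_div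
    exact sInf_le ⟨h, hh, hz, h0, rfl⟩

noncomputable def cut {X : Type*} [MetricSpace X] (x0 : X) (R : ℝ) (x : X) : ℝ :=
  max 0 (min 1 (R + 1 - dist x x0))

section cut
variable {X : Type*} [MetricSpace X] (x0 : X) (R : ℝ)

lemma cut_nonneg (x : X) : 0 ≤ cut x0 R x := le_max_left _ _
lemma cut_le_one (x : X) : cut x0 R x ≤ 1 := max_le zero_le_one (min_le_left _ _)
lemma cut_eq_one {x : X} (h : dist x x0 ≤ R) : cut x0 R x = 1 := by
  unfold cut
  rw [min_eq_left (by linarith), max_eq_right zero_le_one]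
lemma cut_eq_zero {x : X} (h : R + 1 ≤ dist x x0) : cut x0 R x = 0 := by
  unfold cut
  rw [max_eq_left]
  exact (min_le_right _ _).trans (by linarith)
lemma cut_lip (x y : X) : |cut x0 R x - cut x0 R y| ≤ dist x y := by
  unfold cut
  have h1 := abs_max_sub_max_le_abs (min 1 (R + 1 - dist x x0)) (min 1 (R + 1 - dist y x0)) 0
  have h2 := abs_min_sub_min_le_max 1 (R + 1 - dist x x0) 1 (R + 1 - dist y x0)
  have h3 := abs_dist_sub_le x y x0
  rw [max_comm 0, max_comm 0]
  refine h1.trans (h2.trans (max_le (by simp) ?_))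
  rw [show R + 1 - dist x x0 - (R + 1 - dist y x0) = -(dist x x0 - dist y x0) by ring, abs_neg]
  exact h3
lemma cut_cont : Continuous (cut x0 R) := by
  unfold cut; fun_prop
end cut

lemma sg_nonneg {b t : ℝ} (ht : 0 ≤ t) : 0 ≤ sg b t := by unfold sg; positivity
lemma sg_nonpos {b t : ℝ} (ht : t ≤ 0) : sg b t ≤ 0 :=
  mul_nonpos_of_nonneg_of_nonpos (by positivity) ht

section step
variable {X : Type*} [MetricSpace X] [MeasurableSpace X] [BorelSpace X]
  (m : Measure X) [IsFiniteMeasure m]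

lemma exists_c {f : X → ℝ} (hf : Continuous f) {C : ℝ} (hC : ∀ x, |f x| ≤ C) (hC0 : 0 ≤ C)
    {p b : ℝ} (hp : 1 < p) (hb : 0 < b) (x0 : X) (R : ℝ) :
    ∃ c, |c| ≤ C ∧ ∫ x, sg (p - 2) (sg b (f x - c) * cut x0 R x) ∂m = 0 := by
  have hs1 := continuous_sg (b := p - 2) (by linarith)
  have hs2 := continuous_sg (b := b) (by linarith)
  have hcut := cut_cont x0 R
  have hcont : ContinuousOn (fun c => ∫ x, sg (p - 2) (sg b (f x - c) * cut x0 R x) ∂m)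
      (Set.Icc (-C) C) := by
    apply continuousOn_of_dominated (bound := fun _ => ((2 * C) ^ (b + 1)) ^ (p - 2 + 1))
    · intro c _
      have : Measurable (fun x => sg (p - 2) (sg b (f x - c) * cut x0 R x)) := by
        have h1 : Continuous (fun x => sg b (f x - c)) := hs2.comp (hf.sub continuous_const)
        exact hs1.measurable.comp (h1.measurable.mul hcut.measurable)
      exact this.aestronglyMeasurable
    · intro c hc
      refine Eventually.of_forall fun x => ?_
      rw [Real.norm_eq_abs, abs_sg (by linarith), abs_mul, abs_sg (by linarith)]
      apply Real.rpow_le_rpow (by positivity) _ (by linarith)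
      rw [abs_of_nonneg (cut_nonneg x0 R x)]
      have h1 : |f x - c| ≤ 2 * C := by
        have := abs_sub (f x) c
        have := hC x
        have := abs_le.2 hc
        linarith
      calc |f x - c| ^ (b + 1) * cut x0 R x ≤ |f x - c| ^ (b + 1) * 1 := by
            gcongr; exact cut_le_one x0 R x
        _ ≤ _ := by rw [mul_one]; gcongr
    · exact integrable_const _
    · refine Eventually.of_forall fun x => Continuous.continuousOn ?_
      exact hs1.comp ((hs2.comp (continuous_const.sub continuous_id)).mul continuous_const)
  have hiv := intermediate_value_Icc' (by linarith : -C ≤ C) hcont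
  have h0 : (0:ℝ) ∈ Set.Icc (∫ x, sg (p - 2) (sg b (f x - C) * cut x0 R x) ∂m)
      (∫ x, sg (p - 2) (sg b (f x - -C) * cut x0 R x) ∂m) := by
    constructor
    · apply integral_nonpos
      intro x
      apply sg_nonpos
      apply mul_nonpos_of_nonpos_of_nonneg _ (cut_nonneg x0 R x)
      apply sg_nonpos
      linarith [(abs_le.1 (hC x)).2]
    · apply integral_nonneg
      intro x
      apply sg_nonneg
      apply mul_nonneg _ (cut_nonneg x0 R x)
      apply sg_nonneg
      linarith [(abs_le.1 (hC x)).1]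
  obtain ⟨c, hc, h⟩ := hiv h0
  exact ⟨c, abs_le.2 hc, h⟩

lemma lintegral_min {f : X → ℝ} (hf : Continuous f) {C : ℝ} (hC : ∀ x, |f x| ≤ C)
    {q : ℝ} (hq : 1 < q) (h0 : ∫ x, sg (q - 2) (f x) ∂m = 0) (c : ℝ) :
    ∫⁻ x, ENNReal.ofReal (|f x| ^ q) ∂m ≤ ∫⁻ x, ENNReal.ofReal (|f x - c| ^ q) ∂m := by
  have hbd : ∀ g : X → ℝ, Continuous g → ∀ M, (∀ x, |g x| ≤ M) → Integrable g m := by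
    intro g hg M hM
    exact Integrable.of_bound hg.measurable.aestronglyMeasurable M (Eventually.of_forall hM)
  have hcq : ∀ c, Continuous (fun x => |f x - c| ^ q) := fun c =>
    (hf.sub continuous_const).abs.rpow_const (fun _ => Or.inr (by linarith))
  have hi : ∀ c, Integrable (fun x => |f x - c| ^ q) m := by
    intro c
    apply hbd _ (hcq c) ((C + |c|) ^ q)
    intro x
    rw [abs_of_nonneg (by positivity)]
    have := abs_sub (f x) c
    have := hC x
    gcongr
    linarith
  have hi0 : Integrable (fun x => |f x| ^ q) m := by simpa using hi 0
  have his : Integrable (fun x => sg (q - 2) (f x)) m := by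
    apply hbd _ ((continuous_sg (by linarith)).comp hf) (C ^ (q - 2 + 1))
    intro x
    rw [Function.comp_apply, abs_sg (by linarith)]
    apply Real.rpow_le_rpow (by positivity) (hC x) (by linarith)
  rw [← ofReal_integral_eq_lintegral_ofReal hi0 (Eventually.of_forall fun x => by positivity),
    ← ofReal_integral_eq_lintegral_ofReal (hi c) (Eventually.of_forall fun x => by positivity)]
  apply ENNReal.ofReal_le_ofReal
  have := integral_mono (hi0.sub (his.const_mul (q * c))) (hi c) (fun x => pt_min hq (f x) c)
  simp only [Pi.sub_apply] at this
  rw [integral_sub hi0 (his.const_mul (q * c)), integral_const_mul, h0] at this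
  simpa using this

lemma step {f : X → ℝ} {K : NNReal} (hf : LipschitzWith K f) {C : ℝ} (hC : ∀ x, |f x| ≤ C)
    (hC0 : 0 ≤ C) {p q : ℝ} (hp : 1 < p) (hpq : p < q)
    (h0 : ∫ x, sg (q - 2) (f x) ∂m = 0) (x0 : X) (R : ℝ) :
    ∃ A D N : ℝ≥0∞, (∫⁻ x, ENNReal.ofReal (|f x| ^ q) ∂m) ≤ A ∧ A ≠ ⊤ ∧
      lambdaOneP m p * D ≤ N ∧
      A ≤ D + ENNReal.ofReal ((2 * C) ^ q) * m (Metric.ball x0 R)ᶜ ∧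
      N ≤ ENNReal.ofReal ((q / p) ^ p) * (A ^ (1 - p / q) *
          (∫⁻ x, ENNReal.ofReal ((lipSlope f x) ^ q) ∂m) ^ (p / q)) +
        ENNReal.ofReal ((q / p * (2 * C) ^ (q / p - 1) * K + (2 * C) ^ (q / p)) ^ p) *
          m (Metric.ball x0 R)ᶜ := by
  have hp0 : 0 < p := by linarith
  have hq0 : 0 < q := by linarith
  have hr : 1 < q / p := (one_lt_div hp0).2 hpq
  set r := q / p with hrdef
  have hrp : r * p = q := div_mul_cancel₀ _ hp0.ne'
  obtain ⟨c, hc, hbal⟩ := exists_c m hf.continuous hC hC0 hp (b := r - 1) (by linarith) x0 R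
  set h : X → ℝ := fun x => sg (r - 1) (f x - c) * cut x0 R x with hdef
  have hfc : ∀ x, |f x - c| ≤ 2 * C := fun x => by
    have := abs_sub (f x) c
    have := hC x
    linarith
  set Λ : ℝ := r * (2 * C) ^ (r - 1) * K + (2 * C) ^ r with hΛ
  have hΛ0 : 0 ≤ Λ := by positivity
  have hlip : LipschitzWith Λ.toNNReal h := by
    apply LipschitzWith.of_dist_le_mul
    intro x y
    rw [Real.coe_toNNReal _ hΛ0, Real.dist_eq]
    have e : h x - h y = (sg (r - 1) (f x - c) - sg (r - 1) (f y - c)) * cut x0 R x +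
        sg (r - 1) (f y - c) * (cut x0 R x - cut x0 R y) := by simp only [hdef]; ring
    have h1 := sg_lip (b := r - 1) (by linarith) (hfc x) (hfc y)
    have h2 : |sg (r - 1) (f y - c)| ≤ (2 * C) ^ r := by
      rw [abs_sg (by linarith), sub_add_cancel]
      exact Real.rpow_le_rpow (by positivity) (hfc y) (by linarith)
    have h3 : |f x - c - (f y - c)| ≤ K * dist x y := by
      simpa [Real.dist_eq] using hf.dist_le_mul x y
    rw [e]
    refine (abs_add_le _ _).trans ?_
    rw [abs_mul, abs_mul, abs_of_nonneg (cut_nonneg x0 R x), add_mul]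
    have h4 := cut_lip x0 R x y
    rw [sub_add_cancel] at h1
    apply add_le_add
    · calc _ ≤ |sg (r - 1) (f x - c) - sg (r - 1) (f y - c)| * 1 := by
            gcongr; exact cut_le_one x0 R x
        _ ≤ r * (2 * C) ^ (r - 1) * |f x - c - (f y - c)| := by rw [mul_one]; exact h1
        _ ≤ r * (2 * C) ^ (r - 1) * (K * dist x y) := by gcongr
        _ = _ := by ring
    · gcongr
  have hsupp : Bornology.IsBounded (Function.support h) := by
    apply (Metric.isBounded_ball (x := x0) (r := R + 1)).subset
    intro x hx
    by_contra hx'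
    apply hx
    rw [Metric.mem_ball, not_lt] at hx'
    simp [hdef, cut_eq_zero x0 R hx']
  have hmeasf : Measurable f := hf.continuous.measurable
  have hmeasball : MeasurableSet (Metric.ball x0 R)ᶜ := Metric.isOpen_ball.measurableSet.compl
  refine ⟨∫⁻ x, ENNReal.ofReal (|f x - c| ^ q) ∂m, ∫⁻ x, ENNReal.ofReal (|h x| ^ p) ∂m,
    ∫⁻ x, ENNReal.ofReal ((lipSlope h x) ^ p) ∂m,
    lintegral_min m hf.continuous hC (by linarith) h0 c, ?_,
    lam_mul_le m hp ⟨⟨_, hlip⟩, hsupp⟩ hbal, ?_, ?_⟩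
  · refine ne_top_of_le_ne_top (b := ∫⁻ x, ENNReal.ofReal ((2 * C) ^ q) ∂m) ?_ ?_
    · rw [lintegral_const]; exact ENNReal.mul_ne_top ENNReal.ofReal_ne_top (measure_ne_top _ _)
    · apply lintegral_mono
      intro x
      apply ENNReal.ofReal_le_ofReal
      exact Real.rpow_le_rpow (by positivity) (hfc x) (by linarith)
  · rw [← lintegral_indicator_const hmeasball, ← lintegral_add_right _ (measurable_const.indicator hmeasball)]
    apply lintegral_mono
    intro x
    by_cases hx : x ∈ Metric.ball x0 R
    · have : |h x| ^ p = |f x - c| ^ q := by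
        simp only [hdef]
        rw [cut_eq_one x0 R (Metric.mem_ball.1 hx).le, mul_one, abs_sg (by linarith), sub_add_cancel,
          ← Real.rpow_mul (abs_nonneg _), hrp]
      simp [this]
    · have hx' : x ∈ (Metric.ball x0 R)ᶜ := hx
      simp only [Set.indicator_of_mem hx']
      refine le_add_left (ENNReal.ofReal_le_ofReal ?_)
      exact Real.rpow_le_rpow (by positivity) (hfc x) (by linarith)
  · have hmf : Measurable (fun x => ENNReal.ofReal (|f x - c| ^ q)) := by fun_prop
    have hml : Measurable (fun x => ENNReal.ofReal (lipSlope f x ^ q)) :=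
      ((measurable_lipSlope hf).pow_const q).ennreal_ofReal
    have hpq1 : p / q ≤ 1 := (div_le_one hq0).2 hpq.le
    have hH := ENNReal.lintegral_mul_norm_pow_le hmf.aemeasurable (μ := m) hml.aemeasurable
      (p := 1 - p / q) (q := p / q) (by linarith) (by positivity) (by ring)
    refine le_trans ?_ (add_le_add_left (mul_le_mul_right hH _) _)
    rw [← lintegral_indicator_const hmeasball, ← lintegral_const_mul' _ _ ENNReal.ofReal_ne_top,
      ← lintegral_add_right _ (measurable_const.indicator hmeasball)]
    apply lintegral_mono
    intro x
    have hn := lipSlope_nonneg hlip x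
    have hnf := lipSlope_nonneg hf x
    by_cases hx : x ∈ Metric.ball x0 R
    · refine le_add_right ?_
      have hch : lipSlope h x ≤ (r - 1 + 1) * |f x - c| ^ (r - 1) * lipSlope f x := by
        apply lipSlope_chain hf (by linarith)
        filter_upwards [Metric.isOpen_ball.mem_nhds hx] with y hy
        simp only [hdef]
        rw [cut_eq_one x0 R (Metric.mem_ball.1 hy).le, mul_one]
      rw [sub_add_cancel] at hch
      rw [ENNReal.ofReal_rpow_of_nonneg (by positivity) (by linarith),
        ENNReal.ofReal_rpow_of_nonneg (by positivity) (by positivity),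
        ← ENNReal.ofReal_mul (by positivity), ← ENNReal.ofReal_mul (by positivity)]
      apply ENNReal.ofReal_le_ofReal
      refine (Real.rpow_le_rpow hn hch hp0.le).trans_eq ?_
      rw [Real.mul_rpow (by positivity) hnf, Real.mul_rpow (by positivity) (by positivity),
        ← Real.rpow_mul (abs_nonneg _), ← Real.rpow_mul (abs_nonneg _), ← Real.rpow_mul hnf,
        mul_div_cancel₀ _ hq0.ne', mul_assoc]
      congr 3
      rw [sub_mul, hrp]; field_simp
    · have hx' : x ∈ (Metric.ball x0 R)ᶜ := hx
      simp only [Set.indicator_of_mem hx']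
      refine le_add_left (ENNReal.ofReal_le_ofReal ?_)
      refine Real.rpow_le_rpow hn ?_ hp0.le
      have := lipSlope_le hlip x
      rwa [Real.coe_toNNReal _ hΛ0] at this
end step

lemma tail_tendsto {X : Type*} [MetricSpace X] [MeasurableSpace X] [BorelSpace X]
    (m : Measure X) [IsFiniteMeasure m] (x0 : X) :
    Tendsto (fun n : ℕ => m (Metric.ball x0 n)ᶜ) atTop (𝓝 0) := by
  have h := tendsto_measure_iInter_atTop (μ := m) (s := fun n : ℕ => (Metric.ball x0 (n:ℝ))ᶜ)
    (fun n => Metric.isOpen_ball.measurableSet.compl.nullMeasurableSet)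
    (fun a b hab => Set.compl_subset_compl.2 (Metric.ball_subset_ball (by exact_mod_cast hab)))
    ⟨0, measure_ne_top _ _⟩
  have e : (⋂ n : ℕ, (Metric.ball x0 (n:ℝ))ᶜ) = ∅ := by
    rw [← Set.compl_iUnion, Metric.iUnion_ball_nat, Set.compl_univ]
  rwa [e, measure_empty] at h

lemma limit_arg {L A0 B M1 M2 c : ℝ≥0∞} {s : ℝ} (hs0 : 0 < s) (hs1 : s < 1)
    (hA0 : A0 ≠ 0) (hM1 : M1 ≠ ⊤) (hM2 : M2 ≠ ⊤) (hc : c ≠ ⊤) (hB : B ≠ ⊤)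
    {e : ℕ → ℝ≥0∞} (he : Tendsto e atTop (𝓝 0)) (hef : ∀ n, e n ≠ ⊤)
    (H : ∀ n, ∃ A D N : ℝ≥0∞, A0 ≤ A ∧ A ≠ ⊤ ∧ L * D ≤ N ∧ A ≤ D + M1 * e n ∧
      N ≤ c * (A ^ (1 - s) * B ^ s) + M2 * e n) :
    L ≤ c * (B / A0) ^ s := by
  have hL : L ≠ ⊤ := by
    rintro rfl
    have : ∀ n, A0 ≤ M1 * e n := by
      intro n
      obtain ⟨A, D, N, h1, h2, h3, h4, h5⟩ := H n
      have hN : N ≠ ⊤ := by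
        refine ne_top_of_le_ne_top ?_ h5
        refine ENNReal.add_ne_top.2 ⟨ENNReal.mul_ne_top hc (ENNReal.mul_ne_top ?_ ?_),
          ENNReal.mul_ne_top hM2 (hef n)⟩
        · exact ENNReal.rpow_ne_top_of_nonneg (by linarith) h2
        · exact ENNReal.rpow_ne_top_of_nonneg (by linarith) hB
      have hD : D = 0 := by
        by_contra hD
        rw [ENNReal.top_mul hD] at h3
        exact hN (top_le_iff.1 h3)
      rw [hD, zero_add] at h4
      exact h1.trans h4
    have ht := ENNReal.Tendsto.const_mul (a := M1) he (Or.inr hM1)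
    rw [mul_zero] at ht
    exact hA0 (le_antisymm (ge_of_tendsto' ht this) bot_le)
  have key : ∀ n, L ≤ c * (B / A0) ^ s + (M2 + L * M1) / A0 * e n := by
    intro n
    obtain ⟨A, D, N, h1, h2, h3, h4, h5⟩ := H n
    have hA : A ≠ 0 := fun h => hA0 (le_antisymm (h ▸ h1) bot_le)
    have h6 : L * A ≤ c * (A ^ (1 - s) * B ^ s) + (M2 + L * M1) * e n := by
      calc L * A ≤ L * (D + M1 * e n) := by gcongr
        _ = L * D + L * M1 * e n := by ring
        _ ≤ c * (A ^ (1 - s) * B ^ s) + M2 * e n + L * M1 * e n := by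
            gcongr; exact h3.trans h5
        _ = _ := by ring
    have h7 : L ≤ (c * (A ^ (1 - s) * B ^ s) + (M2 + L * M1) * e n) / A :=
      (ENNReal.le_div_iff_mul_le (Or.inl hA) (Or.inl h2)).2 h6
    refine h7.trans ?_
    rw [ENNReal.add_div]
    have e1 : c * (A ^ (1 - s) * B ^ s) / A = c * (B / A) ^ s := by
      rw [ENNReal.div_rpow_of_nonneg _ _ hs0.le, ENNReal.rpow_sub _ _ hA h2, ENNReal.rpow_one,
        div_eq_mul_inv, div_eq_mul_inv, div_eq_mul_inv]
      calc c * (A * (A ^ s)⁻¹ * B ^ s) * A⁻¹ = c * (B ^ s * (A ^ s)⁻¹) * (A * A⁻¹) := by ring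
        _ = _ := by rw [ENNReal.mul_inv_cancel hA h2, mul_one]
    rw [e1]
    apply add_le_add
    · gcongr
    · rw [div_eq_mul_inv, div_eq_mul_inv, mul_right_comm]
      gcongr
  have ht : Tendsto (fun n => c * (B / A0) ^ s + (M2 + L * M1) / A0 * e n) atTop
      (𝓝 (c * (B / A0) ^ s + (M2 + L * M1) / A0 * 0)) := by
    apply Tendsto.const_add
    apply ENNReal.Tendsto.const_mul he (Or.inr _)
    exact ENNReal.div_ne_top (ENNReal.add_ne_top.2 ⟨hM2, ENNReal.mul_ne_top hL hM1⟩) hA0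
  rw [mul_zero, add_zero] at ht
  exact ge_of_tendsto' ht key

/-- For a complete separable metric measure space with `0 < m(X) < ∞` and `m` finite on
bounded sets, the function `p ↦ p · (λ_{1,p})^{1/p}` is monotone:
for `1 < p < q < ∞`, `p · (λ_{1,p})^{1/p} ≤ q · (λ_{1,q})^{1/q}`. -/
theorem lambdaOneP_monotone {X : Type*} [MetricSpace X] [CompleteSpace X]
    [TopologicalSpace.SeparableSpace X] [MeasurableSpace X] [BorelSpace X]
    (m : Measure X)
    (hbdd : ∀ s : Set X, Bornology.IsBounded s → m s < ⊤)
    (hpos : 0 < m Set.univ) (hfin : m Set.univ < ⊤)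
    (p q : ℝ) (hp : 1 < p) (hpq : p < q) :
    ENNReal.ofReal p * (lambdaOneP m p) ^ (1 / p) ≤
      ENNReal.ofReal q * (lambdaOneP m q) ^ (1 / q) := by
  have : IsFiniteMeasure m := ⟨hfin⟩
  have hp0 : 0 < p := by linarith
  have hq0 : 0 < q := by linarith
  have hne : Nonempty X := by
    by_contra h
    rw [not_nonempty_iff] at h
    simp [Set.univ_eq_empty_iff.2 h] at hpos
  obtain ⟨x0⟩ := hne
  have main : ∀ l, (∃ f : X → ℝ, LipBS f ∧ ¬ (f =ᵐ[m] 0) ∧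
      (∫ x, |f x| ^ (q - 2) * f x ∂m) = 0 ∧
      l = (∫⁻ x, ENNReal.ofReal ((lipSlope f x) ^ q) ∂m) /
        (∫⁻ x, ENNReal.ofReal (|f x| ^ q) ∂m)) →
      lambdaOneP m p ≤ ENNReal.ofReal ((q / p) ^ p) * l ^ (p / q) := by
    rintro l ⟨f, ⟨⟨K, hf⟩, hb⟩, hnz, h0, rfl⟩
    obtain ⟨C, hC0, hC⟩ : ∃ C : ℝ, 0 ≤ C ∧ ∀ x, |f x| ≤ C := by
      obtain ⟨D, hD⟩ := hb.subset_closedBall x0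
      refine ⟨|f x0| + K * |D|, by positivity, fun x => ?_⟩
      by_cases hx : f x = 0
      · rw [hx, abs_zero]; positivity
      · have h1 : dist x x0 ≤ D := hD hx
        have h2 := hf.dist_le_mul x x0
        rw [Real.dist_eq] at h2
        have h3 : (K : ℝ) * dist x x0 ≤ K * |D| := by
          gcongr; exact h1.trans (le_abs_self D)
        have h4 := abs_sub_abs_le_abs_sub (f x) (f x0)
        linarith
    have hmeas : Measurable f := hf.continuous.measurable
    have hA0 : (∫⁻ x, ENNReal.ofReal (|f x| ^ q) ∂m) ≠ 0 := by
      intro h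
      rw [lintegral_eq_zero_iff (by fun_prop)] at h
      apply hnz
      filter_upwards [h] with x hx
      by_contra hx0
      have : 0 < |f x| ^ q := Real.rpow_pos_of_pos (abs_pos.2 hx0) q
      simp only [Pi.zero_apply, ENNReal.ofReal_eq_zero] at hx
      linarith
    refine limit_arg (by positivity) ((div_lt_one hq0).2 hpq) hA0 ENNReal.ofReal_ne_top
      ENNReal.ofReal_ne_top ENNReal.ofReal_ne_top ?_ (tail_tendsto m x0)
      (fun n => measure_ne_top _ _) (fun n => step m hf hC hC0 hp hpq h0 x0 n)
    refine ne_top_of_le_ne_top (b := ∫⁻ x, ENNReal.ofReal ((K : ℝ) ^ q) ∂m) ?_ ?_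
    · rw [lintegral_const]; exact ENNReal.mul_ne_top ENNReal.ofReal_ne_top (measure_ne_top _ _)
    · apply lintegral_mono
      intro x
      apply ENNReal.ofReal_le_ofReal
      exact Real.rpow_le_rpow (lipSlope_nonneg hf x) (lipSlope_le hf x) (by linarith)
  have hQ0 : ENNReal.ofReal q ≠ 0 := by simpa using hq0
  have h1 : ((ENNReal.ofReal q)⁻¹ * (ENNReal.ofReal p * lambdaOneP m p ^ (1 / p))) ^ q ≤
      lambdaOneP m q := by
    apply le_sInf
    rintro l hl
    have h2 := main l hl
    have h3 : lambdaOneP m p ^ (1 / p) ≤ ENNReal.ofReal (q / p) * l ^ (1 / q) := by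
      refine (ENNReal.rpow_le_rpow h2 (by positivity)).trans_eq ?_
      rw [ENNReal.mul_rpow_of_nonneg _ _ (by positivity), ← ENNReal.rpow_mul,
        ENNReal.ofReal_rpow_of_nonneg (by positivity) (by positivity),
        ← Real.rpow_mul (by positivity), mul_one_div_cancel hp0.ne', Real.rpow_one]
      congr 2
      field_simp
    have h4 : (ENNReal.ofReal q)⁻¹ * (ENNReal.ofReal p * lambdaOneP m p ^ (1 / p)) ≤ l ^ (1 / q) := by
      calc _ ≤ (ENNReal.ofReal q)⁻¹ * (ENNReal.ofReal p * (ENNReal.ofReal (q / p) * l ^ (1 / q))) := by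
            gcongr
        _ = (ENNReal.ofReal q)⁻¹ * (ENNReal.ofReal p * ENNReal.ofReal (q / p)) * l ^ (1 / q) := by
            ring
        _ = _ := by
            rw [← ENNReal.ofReal_mul hp0.le, mul_div_cancel₀ _ hp0.ne',
              ENNReal.inv_mul_cancel hQ0 ENNReal.ofReal_ne_top, one_mul]
    refine (ENNReal.rpow_le_rpow h4 hq0.le).trans_eq ?_
    rw [← ENNReal.rpow_mul, one_div_mul_cancel hq0.ne', ENNReal.rpow_one]
  have h5 := ENNReal.rpow_le_rpow h1 (by positivity : 0 ≤ 1 / q)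
  rw [← ENNReal.rpow_mul, mul_one_div_cancel hq0.ne', ENNReal.rpow_one] at h5
  calc _ = ENNReal.ofReal q * ((ENNReal.ofReal q)⁻¹ * (ENNReal.ofReal p * lambdaOneP m p ^ (1 / p))) := by
        rw [← mul_assoc, ENNReal.mul_inv_cancel hQ0 ENNReal.ofReal_ne_top, one_mul]
    _ ≤ _ := by gcongr
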